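/- arXiv:2205.02398 — 3 statements merged into one kernel-verified Lean document; each statement's English description precedes it below -/
import Mathlib

section
/- Let N, M, d ≥ 1, let w ∈ ℝ^M and let W = diag(w₁,…,w_M). Let Φ ∈ ℝ^{M×N} and D₁,…,D_d ∈ ℝ^{M×N} be matrices, define A = Φᵀ W Φ and B = Σ_{i=1}^d D_iᵀ W D_i, and assume A is invertible. Let F : ℝ → ℝ be continuously differentiable. Let α, β : ℝ → ℝ^N be differentiable with α'(t) = β(t) and β'(t) = −A⁻¹ B α(t) − Υ(t) for all t, where Υ(t) = A⁻¹ Φᵀ W v(t) and v(t) ∈ ℝ^M is the vector with entries v_j(t) = F'((Φα(t))_j). Then the discrete energy E^d(t) = ½ β(t)ᵀ A β(t) + ½ α(t)ᵀ B α(t) + Σ_{j=1}^M w_j F((Φα(t))_j) is constant in t. -/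
open Matrix

section Derivatives

variable {m n : Type*} [Fintype n]

theorem HasDerivAt.mulVec_const_left [Fintype m] (S : Matrix m n ℝ) {u : ℝ → n → ℝ} {u' : n → ℝ}
    {t : ℝ} (hu : HasDerivAt u u' t) : HasDerivAt (fun s => S *ᵥ u s) (S *ᵥ u') t :=
  (LinearMap.toContinuousLinearMap S.mulVecLin).hasFDerivAt.comp_hasDerivAt t hu

theorem HasDerivAt.dotProduct_vec {u v : ℝ → n → ℝ} {u' v' : n → ℝ} {t : ℝ}
    (hu : HasDerivAt u u' t) (hv : HasDerivAt v v' t) :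
    HasDerivAt (fun s => u s ⬝ᵥ v s) (u' ⬝ᵥ v t + u t ⬝ᵥ v') t := by
  simp only [dotProduct, ← Finset.sum_add_distrib]
  exact HasDerivAt.fun_sum fun i _ => (hasDerivAt_pi.1 hu i).mul (hasDerivAt_pi.1 hv i)

theorem Matrix.IsSymm.dotProduct_mulVec_comm {S : Matrix n n ℝ} (hS : S.IsSymm) (x y : n → ℝ) :
    x ⬝ᵥ S *ᵥ y = y ⬝ᵥ S *ᵥ x := by
  rw [dotProduct_mulVec, ← mulVec_transpose, hS.eq, dotProduct_comm]

theorem Matrix.IsSymm.hasDerivAt_half_quadraticForm {S : Matrix n n ℝ} (hS : S.IsSymm)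
    {u : ℝ → n → ℝ} {u' : n → ℝ} {t : ℝ} (hu : HasDerivAt u u' t) :
    HasDerivAt (fun s => (1 / 2) * (u s ⬝ᵥ S *ᵥ u s)) (u t ⬝ᵥ S *ᵥ u') t := by
  refine ((hu.dotProduct_vec (hu.mulVec_const_left S)).const_mul (1 / 2)).congr_deriv ?_
  rw [hS.dotProduct_mulVec_comm u' (u t)]
  ring

end Derivatives

theorem Matrix.isSymm_transpose_mul_diagonal_mul {m n : Type*} [Fintype m] [DecidableEq m]
    (w : m → ℝ) (P : Matrix m n ℝ) : (Pᵀ * diagonal w * P).IsSymm := by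
  simp [IsSymm, transpose_mul, Matrix.mul_assoc]

/-- Theorem 4.2: the semi-discrete meshless Galerkin system with quadrature
(weights `w`, kernel matrix `Φ`, derivative matrices `D i`) conserves the
discrete energy `E^d(t) = ½βᵀAβ + ½αᵀBα + Σⱼ wⱼ F((Φα)ⱼ)`. -/
theorem discrete_energy_conservation_semidiscrete
    {N M d : ℕ} (hN : 1 ≤ N) (hM : 1 ≤ M) (hd : 1 ≤ d)
    (w : Fin M → ℝ)
    (Φ : Matrix (Fin M) (Fin N) ℝ)
    (D : Fin d → Matrix (Fin M) (Fin N) ℝ)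
    (A B : Matrix (Fin N) (Fin N) ℝ)
    (hA : A = Φᵀ * Matrix.diagonal w * Φ)
    (hB : B = ∑ i : Fin d, (D i)ᵀ * Matrix.diagonal w * D i)
    (hAinv : IsUnit A)
    (F : ℝ → ℝ) (hF : ContDiff ℝ 1 F)
    (α β : ℝ → Fin N → ℝ)
    (hαβ : ∀ t : ℝ, HasDerivAt α (β t) t)
    (hODE : ∀ t : ℝ, HasDerivAt β
      (-(A⁻¹ * B).mulVec (α t)
        - A⁻¹.mulVec (Φᵀ.mulVec ((Matrix.diagonal w).mulVec
            (fun j => deriv F (Φ.mulVec (α t) j))))) t) :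
    ∀ t₁ t₂ : ℝ,
      (1 / 2) * (β t₁ ⬝ᵥ A.mulVec (β t₁))
          + (1 / 2) * (α t₁ ⬝ᵥ B.mulVec (α t₁))
          + ∑ j : Fin M, w j * F (Φ.mulVec (α t₁) j)
        = (1 / 2) * (β t₂ ⬝ᵥ A.mulVec (β t₂))
          + (1 / 2) * (α t₂ ⬝ᵥ B.mulVec (α t₂))
          + ∑ j : Fin M, w j * F (Φ.mulVec (α t₂) j) := by
  have hAs : A.IsSymm := hA ▸ isSymm_transpose_mul_diagonal_mul w Φ
  have hBs : B.IsSymm := by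
    rw [hB, IsSymm, transpose_sum]
    exact Finset.sum_congr rfl fun i _ => isSymm_transpose_mul_diagonal_mul w (D i)
  have hdet : IsUnit A.det := (isUnit_iff_isUnit_det A).1 hAinv
  have hE : ∀ t, HasDerivAt (fun s => (1 / 2) * (β s ⬝ᵥ A.mulVec (β s))
      + (1 / 2) * (α s ⬝ᵥ B.mulVec (α s)) + ∑ j : Fin M, w j * F (Φ.mulVec (α s) j)) 0 t := by
    intro t
    have hpot : HasDerivAt (fun s => ∑ j : Fin M, w j * F (Φ.mulVec (α s) j))
        (∑ j : Fin M, w j * (deriv F (Φ.mulVec (α t) j) * Φ.mulVec (β t) j)) t :=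
      HasDerivAt.fun_sum fun j _ => HasDerivAt.const_mul (w j) <|
        ((hF.differentiable one_ne_zero) _).hasDerivAt.comp t
          (hasDerivAt_pi.1 ((hαβ t).mulVec_const_left Φ) j)
    refine (((hAs.hasDerivAt_half_quadraticForm (hODE t)).add
      (hBs.hasDerivAt_half_quadraticForm (hαβ t))).add hpot).congr_deriv ?_
    have hforce : ∀ v : Fin M → ℝ, β t ⬝ᵥ Φᵀ *ᵥ diagonal w *ᵥ v
        = ∑ j, w j * (v j * (Φ *ᵥ β t) j) := by
      intro v
      rw [dotProduct_mulVec, vecMul_transpose]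
      simp only [dotProduct, mulVec_diagonal]
      exact Finset.sum_congr rfl fun j _ => by ring
    rw [mulVec_sub, mulVec_neg, mulVec_mulVec, mulVec_mulVec, mul_nonsing_inv_cancel_left _ _ hdet,
      mul_nonsing_inv _ hdet, one_mulVec, dotProduct_sub, dotProduct_neg, hforce,
      hBs.dotProduct_mulVec_comm (α t)]
    ring
  exact is_const_of_deriv_eq_zero (fun t => (hE t).differentiableAt) fun t => (hE t).deriv
end

section
/- Let N, M ≥ 1, let w ∈ ℝ^M with W = diag(w₁,…,w_M), let Φ ∈ ℝ^{M×N}, let A, B ∈ ℝ^{N×N} with A invertible, let F : ℝ → ℝ, and let τ ≠ 0. Suppose α, α⁺, β, β⁺ ∈ ℝ^N and q ∈ ℝ^M satisfy: (i) q_j · ((Φα⁺)_j − (Φα)_j) = F((Φα⁺)_j) − F((Φα)_j) for every j = 1,…,M, and (ii) (1/τ)(β⁺ − β) = −½ A⁻¹ B (α + α⁺) − A⁻¹ Φᵀ W q. Then (1/τ)(α⁺ − α)ᵀ A (β⁺ − β) = −½ (α⁺ − α)ᵀ B (α⁺ + α) − Σ_{j=1}^M w_j ( F((Φα⁺)_j)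 − F((Φα)_j) ). -/
open Matrix

/-- The key intermediate identity (equation (4.12)) in the proof of energy
conservation of the fully discretized average vector field scheme. -/
theorem avf_momentum_update_identity
    {N M : ℕ} (hN : 1 ≤ N) (hM : 1 ≤ M)
    (w : Fin M → ℝ)
    (Φ : Matrix (Fin M) (Fin N) ℝ)
    (A B : Matrix (Fin N) (Fin N) ℝ) (hAinv : IsUnit A)
    (F : ℝ → ℝ) (τ : ℝ) (hτ : τ ≠ 0)
    (α αp β βp : Fin N → ℝ) (q : Fin M → ℝ)
    (hq : ∀ j : Fin M,
      q j * (Φ.mulVec αp j - Φ.mulVec α j)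
        = F (Φ.mulVec αp j) - F (Φ.mulVec α j))
    (h2 : (1 / τ) • (βp - β)
        = -((1 / 2 : ℝ) • (A⁻¹ * B).mulVec (α + αp))
          - A⁻¹.mulVec (Φᵀ.mulVec ((Matrix.diagonal w).mulVec q))) :
    (1 / τ) * ((αp - α) ⬝ᵥ A.mulVec (βp - β))
      = -(1 / 2) * ((αp - α) ⬝ᵥ B.mulVec (αp + α))
        - ∑ j : Fin M, w j * (F (Φ.mulVec αp j) - F (Φ.mulVec α j)) := by
  have hAA : A * A⁻¹ = 1 := A.mul_nonsing_inv ((A.isUnit_iff_isUnit_det).mp hAinv)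
  have hmom : (1 / τ) • A *ᵥ (βp - β)
      = -((1 / 2 : ℝ) • B *ᵥ (αp + α)) - Φᵀ *ᵥ (diagonal w *ᵥ q) := by
    rw [← mulVec_smul, h2, mulVec_sub, mulVec_neg, mulVec_smul, mulVec_mulVec, mulVec_mulVec,
      ← mul_assoc, hAA, one_mul, one_mulVec, add_comm α αp]
  have hsum : (αp - α) ⬝ᵥ Φᵀ *ᵥ (diagonal w *ᵥ q)
      = ∑ j, w j * (F ((Φ *ᵥ αp) j) - F ((Φ *ᵥ α) j)) := by
    rw [dotProduct_mulVec, vecMul_transpose, mulVec_sub]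
    refine Finset.sum_congr rfl fun j _ => ?_
    rw [← hq j, mulVec_diagonal, Pi.sub_apply]
    ring
  rw [← smul_eq_mul, ← dotProduct_smul, hmom, dotProduct_sub, dotProduct_neg, dotProduct_smul,
    hsum, smul_eq_mul, neg_mul]
end

section
/- Let N, M ≥ 1, let w ∈ ℝ^M with W = diag(w₁,…,w_M), let Φ ∈ ℝ^{M×N}, let A, B ∈ ℝ^{N×N} be symmetric matrices with A invertible, let F : ℝ → ℝ, and let τ ≠ 0. Suppose (α^n, β^n)_{n ∈ ℕ} is a sequence of pairs in ℝ^N × ℝ^N such that for every n there exists q^n ∈ ℝ^M with: (i) q^n_j · ((Φα^{n+1})_j − (Φα^n)_j) = F((Φα^{n+1})_j) − F((Φα^n)_j) for every j; (ii) (1/τ)(α^{n+1} − α^n) = ½(β^n + β^{n+1}); and (iii) (1/τ)(β^{n+1} − β^n) = −½ A⁻¹ B (α^n + α^{n+1}) − A⁻¹ Φᵀ W q^n. Then the discrete energy E^d(α^n, β^n) = ½ (β^n)ᵀ A β^n + ½ (α^n)ᵀ B α^n + Σ_{j=1}^M w_j F((Φα^n)_j) satisfies E^d(α^n, β^n) =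 E^d(α⁰, β⁰) for all n ∈ ℕ. -/
open Matrix

/-- The bilinear form of a symmetric matrix satisfies
`u ⬝ᵥ A *ᵥ v = v ⬝ᵥ A *ᵥ u`. -/
theorem Matrix.IsSymm.dotProduct_mulVec_comm_s10 {ι R : Type*} [Fintype ι] [CommSemiring R]
    {A : Matrix ι ι R} (hA : A.IsSymm) (u v : ι → R) :
    u ⬝ᵥ A *ᵥ v = v ⬝ᵥ A *ᵥ u := by
  rw [dotProduct_mulVec, ← mulVec_transpose, hA.eq, dotProduct_comm]

/-- Difference of squares for the quadratic form of a symmetric matrix. -/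
theorem Matrix.IsSymm.add_dotProduct_mulVec_sub {ι R : Type*} [Fintype ι] [CommRing R]
    {A : Matrix ι ι R} (hA : A.IsSymm) (u v : ι → R) :
    (u + v) ⬝ᵥ A *ᵥ (v - u) = v ⬝ᵥ A *ᵥ v - u ⬝ᵥ A *ᵥ u := by
  rw [mulVec_sub, dotProduct_sub, add_dotProduct, add_dotProduct,
    hA.dotProduct_mulVec_comm_s10 u v]
  ring

/-- One step of the average vector field scheme conserves the discrete energy. -/
theorem avf_step_conserves_discrete_energy {ι κ : Type*} [Fintype ι] [DecidableEq ι]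
    [Fintype κ] [DecidableEq κ] (w : κ → ℝ) (Φ : Matrix κ ι ℝ) {A B : Matrix ι ι ℝ}
    (hA : A.IsSymm) (hB : B.IsSymm) (hAinv : IsUnit A) (F : ℝ → ℝ) (τ : ℝ)
    (a a' b b' : ι → ℝ) (q : κ → ℝ)
    (hq : ∀ j, q j * ((Φ *ᵥ a') j - (Φ *ᵥ a) j) = F ((Φ *ᵥ a') j) - F ((Φ *ᵥ a) j))
    (ha : (1 / τ) • (a' - a) = (1 / 2 : ℝ) • (b + b'))
    (hb : (1 / τ) • (b' - b) =
      -((1 / 2 : ℝ) • (A⁻¹ * B) *ᵥ (a + a')) - A⁻¹ *ᵥ (Φᵀ *ᵥ (diagonal w *ᵥ q))) :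
    (1 / 2) * (b' ⬝ᵥ A *ᵥ b') + (1 / 2) * (a' ⬝ᵥ B *ᵥ a') + ∑ j, w j * F ((Φ *ᵥ a') j) =
      (1 / 2) * (b ⬝ᵥ A *ᵥ b) + (1 / 2) * (a ⬝ᵥ B *ᵥ a) + ∑ j, w j * F ((Φ *ᵥ a) j) := by
  have hAA : A * A⁻¹ = 1 := mul_nonsing_inv A ((isUnit_iff_isUnit_det A).mp hAinv)
  have hforce : (1 / τ) • A *ᵥ (b' - b) =
      -((1 / 2 : ℝ) • B *ᵥ (a + a')) - Φᵀ *ᵥ (diagonal w *ᵥ q) := by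
    rw [← mulVec_smul, hb, mulVec_sub, mulVec_neg, mulVec_smul, mulVec_mulVec, mulVec_mulVec,
      ← Matrix.mul_assoc, hAA, Matrix.one_mul, Matrix.one_mulVec]
  have hkinetic : (a' - a) ⬝ᵥ ((1 / τ) • A *ᵥ (b' - b)) =
      (1 / 2) * (b' ⬝ᵥ A *ᵥ b' - b ⬝ᵥ A *ᵥ b) := by
    rw [dotProduct_smul, ← smul_dotProduct, ha, smul_dotProduct, hA.add_dotProduct_mulVec_sub,
      smul_eq_mul]
  have hstiff : (a' - a) ⬝ᵥ B *ᵥ (a + a') = a' ⬝ᵥ B *ᵥ a' - a ⬝ᵥ B *ᵥ a := by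
    rw [hB.dotProduct_mulVec_comm_s10, hB.add_dotProduct_mulVec_sub]
  have hpotential : (a' - a) ⬝ᵥ Φᵀ *ᵥ (diagonal w *ᵥ q) =
      ∑ j, w j * F ((Φ *ᵥ a') j) - ∑ j, w j * F ((Φ *ᵥ a) j) := by
    rw [dotProduct_mulVec, vecMul_transpose, mulVec_sub, ← Finset.sum_sub_distrib]
    refine Finset.sum_congr rfl fun j _ => ?_
    rw [mulVec_diagonal, Pi.sub_apply, ← mul_sub, ← hq j]
    ring
  rw [hforce, dotProduct_sub, dotProduct_neg, dotProduct_smul, hstiff, hpotential,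
    smul_eq_mul] at hkinetic
  linarith

/-- Global-in-time form of Theorem 4.3: iterating the second-order average
vector field (AVF) scheme conserves the discrete energy at every time level. -/
theorem avf_iterates_conserve_discrete_energy
    {N M : ℕ} (hN : 1 ≤ N) (hM : 1 ≤ M)
    (w : Fin M → ℝ)
    (Φ : Matrix (Fin M) (Fin N) ℝ)
    (A B : Matrix (Fin N) (Fin N) ℝ)
    (hAsymm : A.IsSymm) (hBsymm : B.IsSymm) (hAinv : IsUnit A)
    (F : ℝ → ℝ) (τ : ℝ) (hτ : τ ≠ 0)
    (α β : ℕ → Fin N → ℝ)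
    (hstep : ∀ n : ℕ, ∃ q : Fin M → ℝ,
      (∀ j : Fin M,
        q j * (Φ.mulVec (α (n + 1)) j - Φ.mulVec (α n) j)
          = F (Φ.mulVec (α (n + 1)) j) - F (Φ.mulVec (α n) j))
      ∧ (1 / τ) • (α (n + 1) - α n) = (1 / 2 : ℝ) • (β n + β (n + 1))
      ∧ (1 / τ) • (β (n + 1) - β n)
          = -((1 / 2 : ℝ) • (A⁻¹ * B).mulVec (α n + α (n + 1)))
            - A⁻¹.mulVec (Φᵀ.mulVec ((Matrix.diagonal w).mulVec q))) :
    ∀ n : ℕ,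
      (1 / 2) * (β n ⬝ᵥ A.mulVec (β n)) + (1 / 2) * (α n ⬝ᵥ B.mulVec (α n))
          + ∑ j : Fin M, w j * F (Φ.mulVec (α n) j)
        = (1 / 2) * (β 0 ⬝ᵥ A.mulVec (β 0)) + (1 / 2) * (α 0 ⬝ᵥ B.mulVec (α 0))
          + ∑ j : Fin M, w j * F (Φ.mulVec (α 0) j) := by
  intro n
  induction n with
  | zero => rfl
  | succ n ih =>
    obtain ⟨q, hq, ha, hb⟩ := hstep n
    exact (avf_step_conserves_discrete_energy w Φ hAsymm hBsymm hAinv F τ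
      _ _ _ _ q hq ha hb).trans ih
end
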